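/- Let H be a real Hilbert space, D ⊆ H a symmetric set of unit vectors whose closed linear span is dense in H, and let f ∈ A₁(D), i.e., f lies in the closed convex hull of D. Let (f_m)_{m≥0} be the Convex-Relaxed Greedy Algorithm iterates: f₀ = 0, and for m ≥ 1, f_m = (1 − γ_m) f_{m−1} + γ_m g_m where g_m ∈ D satisfies ⟨f − f_{m−1}, g_m⟩ = sup_{g ∈ D} ⟨f − f_{m−1}, g⟩ and γ_m ∈ [0,1] minimizes γ ↦ ‖f − ((1−γ) f_{m−1} + γ g_m)‖² over [0,1]. Then for every m ≥ 0, ‖f − f_m‖ ≤ 2/√(m+4). -/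

import Mathlib

open RealInnerProductSpace

/-- A real inner product functional on the closed convex hull of `D` is bounded by any bound
on `D`. -/
lemma inner_le_of_mem_closure_convexHull {H : Type*} [NormedAddCommGroup H]
    [InnerProductSpace ℝ H] {D : Set H} {r f : H} {S : ℝ} (hS : ∀ x ∈ D, ⟪r, x⟫ ≤ S)
    (hf : f ∈ closure (convexHull ℝ D)) : ⟪r, f⟫ ≤ S := by
  have hconv : Convex ℝ {x : H | ⟪r, x⟫ ≤ S} :=
    convex_halfSpace_le (innerₗ H r).isLinear S
  have hclosed : IsClosed {x : H | ⟪r, x⟫ ≤ S} :=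
    isClosed_le (by fun_prop) continuous_const
  exact closure_minimal (convexHull_min hS hconv) hclosed hf

/-- The closed convex hull of a set of unit vectors lies in the closed unit ball. -/
lemma norm_le_one_of_mem_closure_convexHull {H : Type*} [NormedAddCommGroup H]
    [InnerProductSpace ℝ H] {D : Set H} (hD : ∀ g ∈ D, ‖g‖ = 1) {f : H}
    (hf : f ∈ closure (convexHull ℝ D)) : ‖f‖ ≤ 1 := by
  have hsub : D ⊆ Metric.closedBall (0 : H) 1 := fun x hx => by simp [hD x hx]
  simpa using closure_minimal (convexHull_min hsub (convex_closedBall 0 1))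
    Metric.isClosed_closedBall hf

/-- Moving a quarter of the squared error towards an atom that correlates with the residual at
least as well as `f` does decreases the squared error `a` to at most `a - a ^ 2 / 4`. -/
lemma norm_sub_relaxed_step_sq_le {H : Type*} [NormedAddCommGroup H]
    [InnerProductSpace ℝ H] {f y g : H} (hy : ‖y‖ ≤ 1) (hg : ‖g‖ ≤ 1)
    (h : ⟪f - y, f⟫ ≤ ⟪f - y, g⟫) :
    ‖f - ((1 - ‖f - y‖ ^ 2 / 4) • y + (‖f - y‖ ^ 2 / 4) • g)‖ ^ 2 ≤
      ‖f - y‖ ^ 2 - (‖f - y‖ ^ 2) ^ 2 / 4 := by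
  set t := ‖f - y‖ ^ 2 / 4 with ht
  have ht0 : 0 ≤ t := by positivity
  have hstep : f - ((1 - t) • y + t • g) = (f - y) - t • (g - y) := by module
  have hinner : ‖f - y‖ ^ 2 ≤ ⟪f - y, g - y⟫ := by
    rw [← real_inner_self_eq_norm_sq, inner_sub_right (f - y) f y, inner_sub_right (f - y) g y]
    linarith
  have hnorm : ‖g - y‖ ≤ 2 := (norm_sub_le g y).trans (by linarith)
  have hnorm_sq : ‖g - y‖ ^ 2 ≤ 4 := by nlinarith [norm_nonneg (g - y)]
  rw [hstep, norm_sub_sq_real, real_inner_smul_right, norm_smul, mul_pow, Real.norm_eq_abs,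
    sq_abs]
  nlinarith [mul_le_mul_of_nonneg_left hinner ht0,
    mul_le_mul_of_nonneg_left hnorm_sq (sq_nonneg t)]

/-- One step of the recursion `a ↦ a - a ^ 2 / 4` preserves the bound `4 / n`. -/
lemma sub_sq_div_four_le {a n : ℝ} (hn : 4 ≤ n) (han : a ≤ 4 / n) :
    a - a ^ 2 / 4 ≤ 4 / (n + 1) := by
  have hle : 4 / n ≤ 1 := by rw [div_le_one (by linarith)]; exact hn
  have hmono : a - a ^ 2 / 4 ≤ 4 / n - (4 / n) ^ 2 / 4 := by nlinarith
  refine hmono.trans ?_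
  rw [← sub_nonneg]
  have : 4 / (n + 1) - (4 / n - (4 / n) ^ 2 / 4) = 4 / (n ^ 2 * (n + 1)) := by
    have : n ≠ 0 := by linarith
    have : n + 1 ≠ 0 := by linarith
    field_simp
    ring
  rw [this]
  positivity

/-- Convergence rate of the Convex-Relaxed Greedy Algorithm: with `D` a
symmetric dictionary (unit vectors with dense closed linear span) in a real
Hilbert space and `f ∈ A₁(D)` (the closed convex hull of `D`), the CRGA
iterates satisfy `‖f - f_m‖ ≤ 2/√(m+4)` for all `m ≥ 0`. -/
theorem stmt_10 {H : Type*} [NormedAddCommGroup H] [InnerProductSpace ℝ H]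
    [CompleteSpace H]
    (D : Set H) (hDunit : ∀ g ∈ D, ‖g‖ = 1) (hDsym : ∀ g ∈ D, -g ∈ D)
    (hDdense : Dense (↑(Submodule.span ℝ D) : Set H))
    (f : H) (hf : f ∈ closure (convexHull ℝ D))
    (F g : ℕ → H) (γ : ℕ → ℝ)
    (hF0 : F 0 = 0)
    (hg : ∀ m : ℕ, 1 ≤ m → g m ∈ D ∧
      ⟪f - F (m - 1), g m⟫ = sSup ((fun x => ⟪f - F (m - 1), x⟫) '' D))
    (hγ : ∀ m : ℕ, 1 ≤ m → γ m ∈ Set.Icc (0 : ℝ) 1 ∧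
      ∀ t ∈ Set.Icc (0 : ℝ) 1,
        ‖f - ((1 - γ m) • F (m - 1) + γ m • g m)‖ ^ 2 ≤
          ‖f - ((1 - t) • F (m - 1) + t • g m)‖ ^ 2)
    (hFm : ∀ m : ℕ, 1 ≤ m → F m = (1 - γ m) • F (m - 1) + γ m • g m) :
    ∀ m : ℕ, ‖f - F m‖ ≤ 2 / Real.sqrt ((m : ℝ) + 4) := by
  have key : ∀ m : ℕ, ‖F m‖ ≤ 1 ∧ ‖f - F m‖ ^ 2 ≤ 4 / ((m : ℝ) + 4) := by
    intro m
    induction m with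
    | zero =>
      have hf1 := norm_le_one_of_mem_closure_convexHull hDunit hf
      refine ⟨by simp [hF0], ?_⟩
      simpa [hF0] using hf1
    | succ m ih =>
      obtain ⟨hFle, herr⟩ := ih
      have hm : 1 ≤ m + 1 := Nat.le_add_left 1 m
      obtain ⟨hgD, hgsup⟩ := hg (m + 1) hm
      obtain ⟨⟨hγ0, hγ1⟩, hmin⟩ := hγ (m + 1) hm
      have hstep := hFm (m + 1) hm
      simp only [Nat.add_sub_cancel] at hgsup hmin hstep
      have hgn := hDunit _ hgD
      have hbdd : BddAbove ((fun x => ⟪f - F m, x⟫) '' D) := by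
        refine ⟨‖f - F m‖, ?_⟩
        rintro _ ⟨x, hx, rfl⟩
        simpa [hDunit x hx] using real_inner_le_norm (f - F m) x
      have hcorr : ⟪f - F m, f⟫ ≤ ⟪f - F m, g (m + 1)⟫ := by
        rw [hgsup]
        exact inner_le_of_mem_closure_convexHull
          (fun x hx => le_csSup hbdd (Set.mem_image_of_mem _ hx)) hf
      have hm4 : (4 : ℝ) ≤ (m : ℝ) + 4 := by linarith [m.cast_nonneg (α := ℝ)]
      have hle : ‖f - F m‖ ^ 2 ≤ 1 := herr.trans (by rw [div_le_one (by linarith)]; exact hm4)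
      refine ⟨?_, ?_⟩
      · have hmem := (convex_closedBall (0 : H) 1) (mem_closedBall_zero_iff.2 hFle)
          (mem_closedBall_zero_iff.2 hgn.le) (sub_nonneg.2 hγ1) hγ0 (sub_add_cancel 1 _)
        rw [hstep]
        exact mem_closedBall_zero_iff.1 hmem
      · rw [hstep]
        calc _ ≤ _ := hmin (‖f - F m‖ ^ 2 / 4) ⟨by positivity, by linarith⟩
          _ ≤ _ := norm_sub_relaxed_step_sq_le hFle hgn.le hcorr
          _ ≤ 4 / ((m : ℝ) + 4 + 1) := sub_sq_div_four_le hm4 herr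
          _ = _ := by push_cast; ring_nf
  intro m
  have hpos : (0 : ℝ) ≤ (m : ℝ) + 4 := by positivity
  refine (sq_le_sq₀ (norm_nonneg _) (by positivity)).1 ?_
  rw [div_pow, Real.sq_sqrt hpos]
  norm_num
  exact (key m).2
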